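/- Let Ad⁰(2,𝔽₃) be the representation of the group SL(2, 𝔽₃) over 𝔽₃ on the space of trace-zero 2×2 matrices over 𝔽₃, with action by conjugation. Then the second group cohomology group H²(SL(2, 𝔽₃), Ad⁰(2,𝔽₃)) is trivial (it is the zero module). -/

import Mathlib

/-- The space `Ad⁰(2,𝔽₃)` of trace-zero `2 × 2` matrices over `𝔽₃`. -/
def Ad0 : Submodule (ZMod 3) (Matrix (Fin 2) (Fin 2) (ZMod 3)) where
  carrier := {B | Matrix.trace B = 0}
  add_mem' := by
    intro a b ha hb
    simp only [Set.mem_setOf_eq, Matrix.trace_add] at *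
    rw [ha, hb, add_zero]
  zero_mem' := by simp
  smul_mem' := by
    intro c x hx
    simp only [Set.mem_setOf_eq, Matrix.trace_smul] at *
    rw [hx, smul_zero]

/-- The conjugation action of `SL(2,𝔽₃)` on `Ad⁰(2,𝔽₃)`: `g • B = g B g⁻¹`. -/
noncomputable def adRep :
    Representation (ZMod 3) (Matrix.SpecialLinearGroup (Fin 2) (ZMod 3)) Ad0 where
  toFun g :=
    { toFun := fun B =>
        ⟨(g : Matrix (Fin 2) (Fin 2) (ZMod 3)) * B.1 *
            ((g⁻¹ : Matrix.SpecialLinearGroup (Fin 2) (ZMod 3)) :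
              Matrix (Fin 2) (Fin 2) (ZMod 3)), by
          have h1 : ((g⁻¹ : Matrix.SpecialLinearGroup (Fin 2) (ZMod 3)) :
              Matrix (Fin 2) (Fin 2) (ZMod 3)) * (g : Matrix (Fin 2) (Fin 2) (ZMod 3)) = 1 := by
            rw [← Matrix.SpecialLinearGroup.coe_mul, inv_mul_cancel,
              Matrix.SpecialLinearGroup.coe_one]
          have hB : Matrix.trace B.1 = 0 := B.2
          show Matrix.trace _ = 0
          rw [Matrix.trace_mul_comm, ← mul_assoc, h1, one_mul, hB]⟩
      map_add' := fun B C => Subtype.ext <| by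
        simp [mul_add, add_mul]
      map_smul' := fun c B => Subtype.ext <| by
        simp [Matrix.mul_smul, Matrix.smul_mul] }
  map_one' := by
    apply LinearMap.ext
    intro B
    apply Subtype.ext
    simp
  map_mul' := fun g h => by
    apply LinearMap.ext
    intro B
    apply Subtype.ext
    simp [mul_assoc]

universe u in
open groupCohomology in
/-- If some linear endomorphism `φ` of a representation `A` of a finite group has trace
`∑ g, g φ g⁻¹` equal to the identity, then `H²(G, A)` is zero. -/
theorem groupCohomology.subsingleton_H2_of_sum_conj_eq_id {k G : Type u} [CommRing k] [Group G]
    [Fintype G] (A : Rep.{u} k G) (φ : A →ₗ[k] A)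
    (hφ : ∀ x : A, ∑ g : G, A.ρ g (φ (A.ρ g⁻¹ x)) = x) : Subsingleton (H2 A) := by
  refine subsingleton_of_forall_eq 0 fun x => ?_
  induction x using H2_induction_on with
  | h f =>
    rw [H2π_eq_zero_iff]
    refine ⟨fun g => ∑ l : G, A.ρ (g * l) (φ (A.ρ (g * l)⁻¹ (f (g, l)))), ?_⟩
    funext ⟨g, h⟩
    have reindex : ∑ l : G, A.ρ (g * l) (φ (A.ρ (g * l)⁻¹ (f (g, l)))) =
        ∑ l : G, A.ρ (g * h * l) (φ (A.ρ (g * h * l)⁻¹ (f (g, h * l)))) := by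
      rw [← Equiv.sum_comp (Equiv.mulLeft h)]
      simp [mul_assoc]
    have conj (l : G) : A.ρ g (A.ρ (h * l) (φ (A.ρ (h * l)⁻¹ (f (h, l))))) =
        A.ρ (g * h * l) (φ (A.ρ (g * h * l)⁻¹ (A.ρ g (f (h, l))))) := by
      simp [mul_assoc]
    have cocycle (l : G) : A.ρ g (f (h, l)) - f (g * h, l) + f (g, h * l) = f (g, h) := by
      have := (mem_cocycles₂_iff (f : G × G → A)).1 f.2 g h l
      rw [sub_add_eq_add_sub, sub_eq_iff_eq_add', ← this]
    rw [d₁₂_hom_apply]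
    dsimp only
    rw [reindex, map_sum]
    simp only [conj]
    rw [← Finset.sum_sub_distrib, ← Finset.sum_add_distrib]
    simp only [← map_sub, ← map_add, cocycle]
    exact (Equiv.sum_comp (Equiv.mulLeft (g * h)) fun l =>
      A.ρ l (φ (A.ρ l⁻¹ (f (g, h))))).trans (hφ _)

/-- The matrix `J = !![0, 1; -1, 0]` spans a line stable under the quaternion subgroup of
`SL(2, 𝔽₃)`; this is minus the projection `B ↦ tr(B J) J` onto that line. -/
def adProjection : Ad0 →ₗ[ZMod 3] Ad0 :=
  (LinearMap.toSpanSingleton (ZMod 3) Ad0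
    ⟨!![0, 2; 1, 0], by simp [Ad0, Matrix.trace_fin_two]⟩).comp
    ((Matrix.traceLinearMap (Fin 2) (ZMod 3) (ZMod 3)).comp
      ((LinearMap.mulRight (ZMod 3) !![0, 1; 2, 0]).comp Ad0.subtype))

theorem sum_conj_trace_smul_eq (a b c : ZMod 3) :
    ∑ g : Matrix.SpecialLinearGroup (Fin 2) (ZMod 3),
      g.1 * (Matrix.trace (!![g.1 1 1, -g.1 0 1; -g.1 1 0, g.1 0 0] * !![a, b; c, -a] * g.1 *
        !![0, 1; 2, 0]) • !![0, 2; 1, 0]) * !![g.1 1 1, -g.1 0 1; -g.1 1 0, g.1 0 0] =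
      !![a, b; c, -a] := by
  decide +revert +kernel

theorem sum_conj_adProjection (B : Ad0) :
    ∑ g : Matrix.SpecialLinearGroup (Fin 2) (ZMod 3),
      adRep g (adProjection (adRep g⁻¹ B)) = B := by
  obtain ⟨B, hB⟩ := B
  have hB' : B.trace = 0 := hB
  rw [Matrix.trace_fin_two, add_comm, ← eq_neg_iff_add_eq_zero] at hB'
  have key := sum_conj_trace_smul_eq (B 0 0) (B 0 1) (B 1 0)
  rw [← hB', ← Matrix.eta_fin_two B] at key
  refine Subtype.ext ?_
  rw [AddSubmonoidClass.coe_finset_sum]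
  refine (Finset.sum_congr rfl fun g _ => ?_).trans key
  rw [← Matrix.adjugate_fin_two, ← Matrix.SpecialLinearGroup.coe_inv]
  simp [adRep, adProjection, -Matrix.SpecialLinearGroup.coe_inv]

/-- `H²(SL(2,𝔽₃), Ad⁰(2,𝔽₃)) = 0`. -/
theorem H2_SL2F3_Ad0_trivial :
    Subsingleton (groupCohomology (Rep.of adRep) 2) := by
  exact groupCohomology.subsingleton_H2_of_sum_conj_eq_id _ adProjection sum_conj_adProjection
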